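/- Let e be a positive integer and let A = M_e(ℂ) be the algebra of e×e complex matrices, regarded as a finite-dimensional ℝ-algebra. Let ι : A → A be an ℝ-algebra involution (an ℝ-linear bijection satisfying ι(XY) = ι(Y)ι(X) for all X, Y and ι ∘ ι = id) whose restriction to the center is complex conjugation, i.e. ι(c·I) = c̄·I for every c ∈ ℂ. Then ι is a positive involution — that is, Tr_{A/ℝ}(X·ι(X)) > 0 for every nonzero X ∈ A — if and only if the group { X ∈ A : X·ι(X) = I } is a compact subset of A (with its topology as a finite-dimensional real vector space). -/

import Mathlib

open Matrix

lemma aux_trace (e : ℕ) (Z : Matrix (Fin e) (Fin e) ℂ) :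
    LinearMap.trace ℝ (Matrix (Fin e) (Fin e) ℂ) (LinearMap.mulLeft ℝ Z) =
      2 * e * (Matrix.trace Z).re := by
  rw [LinearMap.trace_eq_matrix_trace _
    (Complex.basisOneI.smulTower (Matrix.stdBasis ℂ (Fin e) (Fin e)))]
  have h : ∀ i j : Fin e, ∀ k : Fin 2,
      LinearMap.toMatrix (Complex.basisOneI.smulTower (Matrix.stdBasis ℂ (Fin e) (Fin e)))
        (Complex.basisOneI.smulTower (Matrix.stdBasis ℂ (Fin e) (Fin e)))
        (LinearMap.mulLeft ℝ Z) (k, (i, j)) (k, (i, j)) = (Z i i).re := by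
    intro i j k
    rw [LinearMap.toMatrix_apply, Module.Basis.smulTower_repr]
    have : (Matrix.stdBasis ℂ (Fin e) (Fin e)).repr (LinearMap.mulLeft ℝ Z
        (Complex.basisOneI.smulTower (Matrix.stdBasis ℂ (Fin e) (Fin e)) (k, (i, j)))) (i, j)
        = Complex.basisOneI k * Z i i := by
      rw [Module.Basis.smulTower_apply]
      simp only [Matrix.stdBasis_eq_single, LinearMap.mulLeft_apply, mul_smul_comm, map_smul,
        Finsupp.smul_apply, smul_eq_mul]
      congr 1
      simp [Matrix.stdBasis, Matrix.mul_apply, Matrix.single_apply]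
    rw [this]
    fin_cases k <;> simp
  simp only [Matrix.trace, Matrix.diag, Fintype.sum_prod_type, h]
  simp [Finset.mul_sum, mul_assoc]

lemma aux_bdd {E : Type*} [NormedAddCommGroup E] [NormedSpace ℝ E] [FiniteDimensional ℝ E]
    (f : E → ℝ) (hf : Continuous f) (hs : ∀ (t : ℝ) X, f (t • X) = t ^ 2 * f X)
    (hp : ∀ X, X ≠ 0 → 0 < f X) (C : ℝ) : Bornology.IsBounded {X | f X = C} := by
  rcases (Metric.sphere (0 : E) 1).eq_empty_or_nonempty with h | h
  · refine (Bornology.isBounded_singleton (x := (0 : E))).subset fun X _ => ?_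
    by_contra h0
    have h0 : X ≠ 0 := h0
    have : (‖X‖⁻¹ • X) ∈ Metric.sphere (0 : E) 1 := by
      simp [norm_smul, h0]
    simp [h] at this
  · have := FiniteDimensional.proper ℝ E
    obtain ⟨Y, hY, hm⟩ := (isCompact_sphere (0 : E) 1).exists_isMinOn h hf.continuousOn
    have hY0 : Y ≠ 0 := by
      rintro rfl
      simp at hY
    have hpos := hp Y hY0
    refine (Metric.isBounded_closedBall (x := (0 : E)) (r := C / f Y + 1)).subset fun X hX => ?_
    have hX : f X = C := hX
    rw [mem_closedBall_zero_iff]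
    by_cases h0 : X = 0
    · subst h0
      have := hs 0 (0 : E)
      simp at this
      have hC : C = 0 := by rw [← hX, this]
      simp [hC]
    have hmem : (‖X‖⁻¹ • X) ∈ Metric.sphere (0 : E) 1 := by
      simp [norm_smul, h0]
    have h1 : f Y ≤ f (‖X‖⁻¹ • X) := hm hmem
    rw [hs, hX] at h1
    have hn : 0 < ‖X‖ := norm_pos_iff.2 h0
    have h2 : ‖X‖ ^ 2 ≤ C / f Y := by
      rw [le_div_iff₀ hpos]
      calc ‖X‖ ^ 2 * f Y ≤ ‖X‖ ^ 2 * (‖X‖⁻¹ ^ 2 * C) := by gcongr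
        _ = C := by field_simp
    nlinarith [sq_nonneg (‖X‖ - 1)]

section
attribute [local instance] Matrix.normedAddCommGroup Matrix.normedSpace

lemma aux_forward (e : ℕ)
    (ι : Matrix (Fin e) (Fin e) ℂ →ₗ[ℝ] Matrix (Fin e) (Fin e) ℂ)
    (h : ∀ X : Matrix (Fin e) (Fin e) ℂ, X ≠ 0 → 0 < LinearMap.trace ℝ (Matrix (Fin e) (Fin e) ℂ)
          (LinearMap.mulLeft ℝ (X * ι X))) :
    IsCompact {X : Matrix (Fin e) (Fin e) ℂ | X * ι X = 1} := by
  have hι : Continuous ι := ι.continuous_of_finiteDimensional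
  have hc : Continuous fun X : Matrix (Fin e) (Fin e) ℂ => X * ι X := continuous_id.matrix_mul hι
  have := FiniteDimensional.proper ℝ (Matrix (Fin e) (Fin e) ℂ)
  refine Metric.isCompact_of_isClosed_isBounded (isClosed_eq hc continuous_const) ?_
  refine (aux_bdd (fun X => LinearMap.trace ℝ (Matrix (Fin e) (Fin e) ℂ)
          (LinearMap.mulLeft ℝ (X * ι X))) ?_ ?_ h (LinearMap.trace ℝ (Matrix (Fin e) (Fin e) ℂ)
          (LinearMap.mulLeft ℝ 1))).subset ?_
  · simp only [aux_trace]
    exact continuous_const.mul (Complex.continuous_re.comp hc.matrix_trace)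
  · intro t X
    simp only [aux_trace, map_smul, smul_mul_assoc, mul_smul_comm, Matrix.trace_smul,
      Complex.real_smul, Complex.re_ofReal_mul]
    ring
  · intro X hX
    have hX : X * ι X = 1 := hX
    simp only [Set.mem_ofPred_eq, hX]

/-- If the group is bounded there is no nonzero self-adjoint square-zero element. -/
lemma aux_nil (e : ℕ)
    (ι : Matrix (Fin e) (Fin e) ℂ →ₗ[ℝ] Matrix (Fin e) (Fin e) ℂ)
    (hanti : ∀ X Y : Matrix (Fin e) (Fin e) ℂ, ι (X * Y) = ι Y * ι X)
    (hcenter : ∀ c : ℂ,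
      ι (c • (1 : Matrix (Fin e) (Fin e) ℂ)) = (starRingEnd ℂ c) • 1)
    (hK : IsCompact {X : Matrix (Fin e) (Fin e) ℂ | X * ι X = 1})
    (N : Matrix (Fin e) (Fin e) ℂ) (hN : ι N = N) (hN2 : N * N = 0) : N = 0 := by
  by_contra h0
  obtain ⟨C, hC⟩ := hK.isBounded.exists_norm_le
  have hsm : ∀ (c : ℂ) (X : Matrix (Fin e) (Fin e) ℂ), ι (c • X) = (starRingEnd ℂ c) • ι X := by
    intro c X
    have := hanti (c • 1) X
    rw [hcenter] at this
    simpa using this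
  have h1 : ι 1 = 1 := by simpa using hcenter 1
  have hmem : ∀ t : ℝ, (1 + (t * Complex.I : ℂ) • N) * ι (1 + (t * Complex.I : ℂ) • N) = 1 := by
    intro t
    rw [map_add, hsm, h1, hN]
    simp [mul_add, add_mul, hN2]
  have hb : ∀ t : ℝ, |t| * ‖N‖ ≤ C + ‖(1 : Matrix (Fin e) (Fin e) ℂ)‖ := by
    intro t
    have h2 := hC _ (hmem t)
    have h3 : ‖(t * Complex.I : ℂ) • N‖ = |t| * ‖N‖ := by rw [norm_smul]; simp
    rw [← h3]
    calc ‖(t * Complex.I : ℂ) • N‖ = ‖(1 + (t * Complex.I : ℂ) • N) - 1‖ := by simp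
      _ ≤ _ := (norm_sub_le _ _).trans (by gcongr)
  have hn : 0 < ‖N‖ := norm_pos_iff.2 h0
  have h4 := hb ((C + ‖(1 : Matrix (Fin e) (Fin e) ℂ)‖ + 1) / ‖N‖)
  have h5 := le_trans (mul_le_mul_of_nonneg_right (le_abs_self _) hn.le) h4
  rw [div_mul_cancel₀ _ hn.ne'] at h5
  linarith
end

/-- Skolem-Noether. -/
lemma aux_SN (e : ℕ) (φ : Matrix (Fin e) (Fin e) ℂ ≃ₐ[ℂ] Matrix (Fin e) (Fin e) ℂ) :
    ∃ P Q : Matrix (Fin e) (Fin e) ℂ, P * Q = 1 ∧ Q * P = 1 ∧ ∀ X, φ X = P * X * Q := by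
  let L : Matrix (Fin e) (Fin e) ℂ ≃ₐ[ℂ] Module.End ℂ (Fin e → ℂ) := Matrix.toLinAlgEquiv'
  obtain ⟨T, hT⟩ := AlgEquiv.eq_linearEquivConjAlgEquiv ((L.symm.trans φ).trans L)
  refine ⟨L.symm T.toLinearMap, L.symm T.symm.toLinearMap, ?_, ?_, ?_⟩
  · rw [← map_mul, ← map_one L.symm]; congr 1; ext; simp
  · rw [← map_mul, ← map_one L.symm]; congr 1; ext; simp
  · intro X
    have := DFunLike.congr_fun hT (L X)
    apply L.injective
    rw [map_mul, map_mul]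
    simp only [AlgEquiv.apply_symm_apply]
    simp only [AlgEquiv.trans_apply, AlgEquiv.symm_apply_apply] at this
    rw [this]
    ext; simp [LinearEquiv.conjAlgEquiv_apply]

section
open scoped ComplexOrder MatrixOrder

/-- An anisotropic hermitian matrix is definite. -/
lemma aux_def (e : ℕ) (Q : Matrix (Fin e) (Fin e) ℂ) (hQ : Q.IsHermitian)
    (h : ∀ v : Fin e → ℂ, star v ⬝ᵥ (Q *ᵥ v) = 0 → v = 0) : Q.PosDef ∨ (-Q).PosDef := by
  have him : ∀ v : Fin e → ℂ, (star v ⬝ᵥ (Q *ᵥ v)).im = 0 := fun v => hQ.im_star_dotProduct_mulVec_self v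
  have hne : ∀ v : Fin e → ℂ, v ≠ 0 → (star v ⬝ᵥ (Q *ᵥ v)).re ≠ 0 := fun v hv h0 =>
    hv (h v (Complex.ext h0 (him v)))
  have key : ∀ v w : Fin e → ℂ, 0 < (star v ⬝ᵥ (Q *ᵥ v)).re → (star w ⬝ᵥ (Q *ᵥ w)).re < 0 → False := by
    intro v w hv hw
    have hexp : ∀ t : ℝ, (star (v + (t : ℂ) • w) ⬝ᵥ (Q *ᵥ (v + (t : ℂ) • w))).re =
        (star v ⬝ᵥ (Q *ᵥ v)).re + t * (star v ⬝ᵥ (Q *ᵥ w) + star w ⬝ᵥ (Q *ᵥ v)).re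
          + t * t * (star w ⬝ᵥ (Q *ᵥ w)).re := by
      intro t
      simp [mulVec_add, mulVec_smul, add_dotProduct, dotProduct_add]
      ring
    set a := (star v ⬝ᵥ (Q *ᵥ v)).re
    set c := (star w ⬝ᵥ (Q *ᵥ w)).re
    set b := (star v ⬝ᵥ (Q *ᵥ w) + star w ⬝ᵥ (Q *ᵥ v)).re
    obtain ⟨t, ht⟩ : ∃ t : ℝ, c * (t * t) + b * t + a = 0 := by
      apply exists_quadratic_eq_zero hw.ne
      refine ⟨Real.sqrt (discrim c b a), (Real.mul_self_sqrt ?_).symm⟩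
      unfold discrim
      nlinarith [sq_nonneg b, mul_neg_of_pos_of_neg hv hw]
    have h0 : v + (t : ℂ) • w = 0 := by
      by_contra hcon
      exact hne _ hcon (by rw [hexp]; linarith)
    have hv' : v = (-t : ℂ) • w := by
      rw [neg_smul]; exact eq_neg_of_add_eq_zero_left h0
    have ha : a = t * t * c := by
      simp only [a, c, hv']
      simp [mulVec_smul, mulVec_neg]
      ring
    nlinarith [mul_self_nonneg t]
  by_cases hex : ∃ w : Fin e → ℂ, (star w ⬝ᵥ (Q *ᵥ w)).re < 0
  · obtain ⟨w, hw⟩ := hex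
    right
    refine PosDef.of_dotProduct_mulVec_pos hQ.neg fun v hv => ?_
    rw [Complex.lt_def]
    have h1 := him v
    have h2 := hne v hv
    have h3 : ¬ 0 < (star v ⬝ᵥ (Q *ᵥ v)).re := fun hh => key v w hh hw
    simp only [neg_mulVec, dotProduct_neg, Complex.neg_re, Complex.neg_im, Complex.zero_re, Complex.zero_im]
    constructor
    · have := lt_of_le_of_ne (not_lt.1 h3) h2
      linarith
    · linarith
  · left
    push Not at hex
    refine PosDef.of_dotProduct_mulVec_pos hQ fun v hv => ?_
    rw [Complex.lt_def]
    exact ⟨lt_of_le_of_ne (hex v) (hne v hv).symm, (him v).symm⟩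

/-- Positivity of the twisted trace. -/
lemma aux_pos (e : ℕ) (P Q : Matrix (Fin e) (Fin e) ℂ) (hP : P.PosDef) (hQ : Q.PosDef)
    (X : Matrix (Fin e) (Fin e) ℂ) (hX : X ≠ 0) : 0 < (Matrix.trace (X * (P * Xᴴ * Q))).re := by
  obtain ⟨B, hBu, rfl⟩ := CStarAlgebra.isStrictlyPositive_iff_eq_star_mul_self.mp
    hQ.isStrictlyPositive
  obtain ⟨C, hCu, rfl⟩ := CStarAlgebra.isStrictlyPositive_iff_eq_star_mul_self.mp
    hP.isStrictlyPositive
  simp only [star_eq_conjTranspose]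
  have h1 : (X * (Cᴴ * C * Xᴴ * (Bᴴ * B))).trace = ((B * X * Cᴴ) * (B * X * Cᴴ)ᴴ).trace := by
    simp only [conjTranspose_mul, conjTranspose_conjTranspose]
    rw [show X * (Cᴴ * C * Xᴴ * (Bᴴ * B)) = (X * Cᴴ * (C * (Xᴴ * Bᴴ))) * B by
      simp only [mul_assoc], trace_mul_comm]
    simp only [mul_assoc]
  rw [h1]
  have h2 : 0 ≤ ((B * X * Cᴴ) * (B * X * Cᴴ)ᴴ).trace :=
    (posSemidef_self_mul_conjTranspose _).trace_nonneg
  have h3 : ((B * X * Cᴴ) * (B * X * Cᴴ)ᴴ).trace ≠ 0 := by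
    intro h
    rw [trace_mul_conjTranspose_self_eq_zero_iff] at h
    apply hX
    have hC' : IsUnit Cᴴ := by rw [← star_eq_conjTranspose]; exact hCu.star
    exact hBu.mul_right_eq_zero.1 (hC'.mul_left_eq_zero.1 h)
  exact (Complex.lt_def.1 (lt_of_le_of_ne h2 h3.symm)).1
end

lemma aux_herm (e : ℕ)
    (ι : Matrix (Fin e) (Fin e) ℂ →ₗ[ℝ] Matrix (Fin e) (Fin e) ℂ)
    (hanti : ∀ X Y : Matrix (Fin e) (Fin e) ℂ, ι (X * Y) = ι Y * ι X)
    (hinvol : ∀ X : Matrix (Fin e) (Fin e) ℂ, ι (ι X) = X)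
    (hcenter : ∀ c : ℂ,
      ι (c • (1 : Matrix (Fin e) (Fin e) ℂ)) = (starRingEnd ℂ c) • 1) :
    ∃ P Q : Matrix (Fin e) (Fin e) ℂ, P * Q = 1 ∧ Q * P = 1 ∧ P.IsHermitian ∧
      ∀ X, ι X = P * Xᴴ * Q := by
  have hsm : ∀ (c : ℂ) (X : Matrix (Fin e) (Fin e) ℂ), ι (c • X) = (starRingEnd ℂ c) • ι X := by
    intro c X
    have := hanti (c • 1) X
    rw [hcenter] at this
    simpa using this
  have h1 : ι 1 = 1 := by simpa using hcenter 1
  let f : Matrix (Fin e) (Fin e) ℂ →ₐ[ℂ] Matrix (Fin e) (Fin e) ℂ :=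
    AlgHom.ofLinearMap
      { toFun := fun X => ι Xᴴ
        map_add' := fun X Y => by simp
        map_smul' := fun c X => by simp [hsm] }
      (by simp [h1]) (fun X Y => by simp [hanti])
  have hf : ∀ X, f X = ι Xᴴ := fun X => rfl
  have hfb : Function.Bijective f := by
    constructor
    · intro X Y h
      rw [hf, hf] at h
      have := congrArg ι h
      rw [hinvol, hinvol] at this
      exact conjTranspose_injective this
    · intro Y
      exact ⟨(ι Y)ᴴ, by rw [hf, conjTranspose_conjTranspose, hinvol]⟩
  obtain ⟨P, Q, hPQ, hQP, hφ⟩ := aux_SN e (AlgEquiv.ofBijective f hfb)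
  have hι : ∀ X, ι X = P * Xᴴ * Q := by
    intro X
    have := hφ Xᴴ
    simpa [hf] using this
  have hQPH : Qᴴ * Pᴴ = 1 := by rw [← conjTranspose_mul, hPQ, conjTranspose_one]
  have hPQH : Pᴴ * Qᴴ = 1 := by rw [← conjTranspose_mul, hQP, conjTranspose_one]
  have hcomm : ∀ X, P * Qᴴ * X = X * (P * Qᴴ) := by
    intro X
    have h := hinvol X
    rw [hι, hι] at h
    simp only [conjTranspose_mul, conjTranspose_conjTranspose] at h
    calc P * Qᴴ * X = P * Qᴴ * X * (Pᴴ * (Q * P) * Qᴴ) := by rw [hQP, mul_one, hPQH, mul_one]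
      _ = (P * (Qᴴ * (X * Pᴴ)) * Q) * (P * Qᴴ) := by simp only [mul_assoc]
      _ = X * (P * Qᴴ) := by rw [h]
  obtain ⟨c, hc⟩ : ∃ c : ℂ, P * Qᴴ = c • 1 := by
    have hmem : P * Qᴴ ∈ Set.range (Matrix.scalar (Fin e)) :=
      Matrix.mem_range_scalar_of_commute_single fun i j _ => (hcomm _).symm
    obtain ⟨c, hc⟩ := hmem
    exact ⟨c, by rw [← hc]; ext i j; simp [Matrix.one_apply, Matrix.diagonal_apply]⟩
  have hP : P = c • Pᴴ := by
    calc P = P * Qᴴ * Pᴴ := by rw [mul_assoc, hQPH, mul_one]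
      _ = c • Pᴴ := by rw [hc]; simp
  have hPH : Pᴴ = (starRingEnd ℂ c) • P := by
    conv_lhs => rw [hP]
    simp
  obtain ⟨u, hu, huP⟩ : ∃ u : ℂ, u ≠ 0 ∧ (u • P).IsHermitian := by
    by_cases h : 1 + starRingEnd ℂ c = 0
    · refine ⟨Complex.I, Complex.I_ne_zero, ?_⟩
      have : starRingEnd ℂ c = -1 := by linear_combination h
      rw [this] at hPH
      simp [Matrix.IsHermitian, hPH]
    · refine ⟨_, h, ?_⟩
      rw [add_smul, one_smul, ← hPH, Matrix.IsHermitian, conjTranspose_add,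
        conjTranspose_conjTranspose, add_comm]
  refine ⟨u • P, u⁻¹ • Q, ?_, ?_, huP, ?_⟩
  · simp [hPQ, smul_smul, hu]
  · simp [hQP, smul_smul, hu]
  · intro X
    simp [hι, smul_smul, hu]


/-- **Positivity of an involution on `M_e(ℂ)` versus compactness of its unitary group.**

Let `A = M_e(ℂ)`, viewed as a finite-dimensional `ℝ`-algebra, and let `ι : A → A` be an
`ℝ`-linear bijection with `ι (X * Y) = ι Y * ι X`, `ι ∘ ι = id`, whose restriction to the
center `ℂ · 1` is complex conjugation.  Then `ι` is a positive involution, i.e.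
`Tr_{A/ℝ}(X * ι X) > 0` for all `X ≠ 0` (where `Tr_{A/ℝ}(a)` is the trace of left
multiplication by `a`), if and only if `{X | X * ι X = 1}` is compact. -/
theorem positive_involution_iff_unitary_group_compact
    (e : ℕ) (he : 0 < e)
    (ι : Matrix (Fin e) (Fin e) ℂ →ₗ[ℝ] Matrix (Fin e) (Fin e) ℂ)
    (hbij : Function.Bijective ι)
    (hanti : ∀ X Y : Matrix (Fin e) (Fin e) ℂ, ι (X * Y) = ι Y * ι X)
    (hinvol : ∀ X : Matrix (Fin e) (Fin e) ℂ, ι (ι X) = X)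
    (hcenter : ∀ c : ℂ,
      ι (c • (1 : Matrix (Fin e) (Fin e) ℂ)) = (starRingEnd ℂ c) • 1) :
    (∀ X : Matrix (Fin e) (Fin e) ℂ, X ≠ 0 →
        0 < LinearMap.trace ℝ (Matrix (Fin e) (Fin e) ℂ)
          (LinearMap.mulLeft ℝ (X * ι X))) ↔
      IsCompact {X : Matrix (Fin e) (Fin e) ℂ | X * ι X = 1} := by
  refine ⟨aux_forward e ι, fun hK X hX => ?_⟩
  obtain ⟨P, Q, hPQ, hQP, hP, hι⟩ := aux_herm e ι hanti hinvol hcenter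
  have hQ : Q.IsHermitian := by
    have h1 : Qᴴ * P = 1 := by
      rw [← hP.eq, ← conjTranspose_mul, hPQ, conjTranspose_one]
    calc Qᴴ = Qᴴ * P * Q := by rw [mul_assoc, hPQ, mul_one]
      _ = Q := by rw [h1, one_mul]
  have haniso : ∀ v : Fin e → ℂ, star v ⬝ᵥ (Q *ᵥ v) = 0 → v = 0 := by
    intro v hv
    have hN := aux_nil e ι hanti hcenter hK (vecMulVec v (star v) * Q) (by
      rw [hι, conjTranspose_mul, hQ.eq, conjTranspose_vecMulVec, star_star,
        ← mul_assoc, hPQ, one_mul]) (by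
      rw [vecMulVec_mul, vecMulVec_mul_vecMulVec, ← dotProduct_mulVec, hv]
      simp)
    have h2 : vecMulVec v (star v) = 0 := by
      calc vecMulVec v (star v) = vecMulVec v (star v) * Q * P := by
            rw [mul_assoc, hQP, mul_one]
        _ = 0 := by rw [hN, zero_mul]
    ext i
    have h3 := congrFun (congrFun h2 i) i
    simpa [vecMulVec_apply] using h3
  rw [aux_trace, hι]
  have he' : (0 : ℝ) < 2 * e := by positivity
  refine mul_pos he' ?_
  rcases aux_def e Q hQ haniso with h | h
  · refine aux_pos e P Q ?_ h X hX
    rw [← Matrix.inv_eq_left_inv hPQ]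
    open scoped ComplexOrder in exact h.inv
  · have := aux_pos e (-P) (-Q) (by
      rw [← Matrix.inv_eq_left_inv (show -P * -Q = 1 by simpa using hPQ)]
      open scoped ComplexOrder in exact h.inv) h X hX
    simpa using this
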